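/- Let O be a finite set of objects and let there be n ≥ 2 agents, where each agent i ∈ {1, …, n} has an additive valuation V_i : 2^O → ℝ≥0 (so V_i(A ∪ B) = V_i(A) + V_i(B) for disjoint A, B ⊆ O). Then there exists a partition of the entire set O into n pairwise-disjoint bundles Z_1 ⊔ ⋯ ⊔ Z_n = O such that for every agent i: V_i(Z_i) ≥ (2/3)·MMS_i^{1,n}(O). -/

import Mathlib

/-- The `l`-out-of-`d` maximin share of an agent with valuation `Vi` over the whole
finite set of objects `α`: the maximum, over all partitions of the objects into `d`
pairwise-disjoint subsets, of the minimum, over all unions of `l` of the subsets,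
of the value of that union. -/
noncomputable def MMS {α : Type*} [Fintype α] [DecidableEq α]
    (Vi : Finset α → ℝ) (l d : ℕ) : ℝ :=
  sSup { t : ℝ | ∃ P : Fin d → Finset α,
    (∀ i j, i ≠ j → Disjoint (P i) (P j)) ∧
    Finset.univ.biUnion P = Finset.univ ∧
    t = sInf { u : ℝ | ∃ S : Finset (Fin d), S.card = l ∧ u = Vi (S.biUnion P) } }

open Finset

/-- `w` admits `k` disjoint groups of objects of `S`, each of value at least `t`; the groups are
the colour classes of the colours in some set `K`. -/
def HasShare {β : Type*} (w : β → ℝ) (S : Finset β) (k : ℕ) (t : ℝ) : Prop :=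
  ∃ (c : β → ℕ) (K : Finset ℕ), K.card = k ∧ ∀ x ∈ K, t ≤ ∑ j ∈ S with c j = x, w j

/-- The objects of `S` can be distributed so that each agent `i ∈ A` gets `2 / 3` of `t i`. -/
def HasAllocation {ι β : Type*} [DecidableEq ι] (w : ι → β → ℝ) (A : Finset ι) (S : Finset β)
    (t : ι → ℝ) : Prop :=
  ∃ f : β → ι, ∀ i ∈ A, 2 / 3 * t i ≤ ∑ j ∈ S with f j = i, w i j

/-- An agent may be given a bundle and removed. -/
theorem HasAllocation.of_erase {ι β : Type*} [DecidableEq ι] [DecidableEq β] {w : ι → β → ℝ}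
    (hw : ∀ i j, 0 ≤ w i j) {A : Finset ι} {S B : Finset β} {t : ι → ℝ} {i₀ : ι} (hB : B ⊆ S)
    (hi₀ : 2 / 3 * t i₀ ≤ ∑ j ∈ B, w i₀ j) (h : HasAllocation w (A.erase i₀) (S \ B) t) :
    HasAllocation w A S t := by
  obtain ⟨f, hf⟩ := h
  refine ⟨fun j => if j ∈ B then i₀ else f j, fun i hi => ?_⟩
  by_cases hii : i = i₀
  · subst hii
    refine hi₀.trans (sum_le_sum_of_subset_of_nonneg ?_ fun j _ _ => hw _ _)
    intro j hj
    simp [hj, hB hj]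
  · refine (hf i (mem_erase.2 ⟨hii, hi⟩)).trans
      (sum_le_sum_of_subset_of_nonneg ?_ fun j _ _ => hw _ _)
    intro j hj
    simp only [mem_filter, mem_sdiff] at hj ⊢
    simp [hj]

theorem HasShare.exists_mem {β : Type*} {w : β → ℝ} (hw : ∀ j, 0 ≤ w j) {S : Finset β} {k : ℕ}
    {t : ℝ} (h : HasShare w S (k + 1) t) :
    ∃ (c : β → ℕ) (K : Finset ℕ), K.card = k + 1 ∧ (∀ j, c j ∈ K) ∧
      ∀ x ∈ K, t ≤ ∑ j ∈ S with c j = x, w j := by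
  obtain ⟨c, K, hK, hc⟩ := h
  obtain ⟨x₀, hx₀⟩ : K.Nonempty := card_pos.1 (by omega)
  refine ⟨fun j => if c j ∈ K then c j else x₀, K, hK, fun j => ?_, fun x hx => ?_⟩
  · dsimp only
    split_ifs <;> assumption
  · refine (hc x hx).trans (sum_le_sum_of_subset_of_nonneg ?_ fun j _ _ => hw _)
    intro j hj
    simp only [mem_filter] at hj ⊢
    simp [hj, hx]

/-- Removing objects of a single colour costs only that colour. -/
theorem HasShare.of_monochromatic {β : Type*} [DecidableEq β] {w : β → ℝ} {S B : Finset β} {k : ℕ}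
    {t : ℝ} {c : β → ℕ} {K : Finset ℕ} (hK : K.card = k + 1)
    (hc : ∀ x ∈ K, t ≤ ∑ j ∈ S with c j = x, w j) {x : ℕ} (hx : x ∈ K) (hB : ∀ j ∈ B, c j = x) :
    HasShare w (S \ B) k t := by
  refine ⟨c, K.erase x, by rw [card_erase_of_mem hx]; omega, fun y hy => ?_⟩
  rw [mem_erase] at hy
  refine (hc y hy.2).trans_eq (sum_congr ?_ fun _ _ => rfl)
  ext j
  simp only [mem_filter, mem_sdiff]
  refine ⟨fun h => ⟨⟨h.1, fun hj => hy.1 ?_⟩, h.2⟩, fun h => ⟨h.1.1, h.2⟩⟩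
  rw [← h.2, hB j hj]

theorem HasShare.sdiff_singleton {β : Type*} [DecidableEq β] {w : β → ℝ} (hw : ∀ j, 0 ≤ w j)
    {S : Finset β} {k : ℕ} {t : ℝ} (h : HasShare w S (k + 1) t) (g : β) :
    HasShare w (S \ {g}) k t := by
  obtain ⟨c, K, hK, hmem, hc⟩ := h.exists_mem hw
  exact HasShare.of_monochromatic hK hc (hmem g) (by simp)

/-- Exchanging an object for one that is at least as valuable. -/
theorem HasShare.exchange {β : Type*} [DecidableEq β] {w : β → ℝ} {R : Finset β} {k : ℕ} {t : ℝ}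
    {b q : β} (hb : b ∉ R) (hq : q ∉ R) (hbq : w b ≤ w q) (h : HasShare w (insert b R) k t) :
    HasShare w (insert q R) k t := by
  obtain ⟨c, K, hK, hc⟩ := h
  refine ⟨Function.update c q (c b), K, hK, fun x hx => (hc x hx).trans ?_⟩
  rw [sum_filter, sum_filter, sum_insert hb, sum_insert hq]
  refine add_le_add ?_ (sum_le_sum fun j hj => ?_)
  · rw [Function.update_self]
    split_ifs
    · exact hbq
    · exact le_rfl
  · rw [Function.update_of_ne (by rintro rfl; exact hq hj)]

theorem HasShare.sdiff_pair_exchange {β : Type*} [DecidableEq β] {w : β → ℝ} {S : Finset β} {k : ℕ}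
    {t : ℝ} {p q b : β} (hq : q ∈ S) (hb : b ∈ S) (hpq : p ≠ q) (hpb : p ≠ b) (hqb : w b ≤ w q)
    (h : HasShare w (S \ {p, q}) k t) : HasShare w (S \ {p, b}) k t := by
  by_cases hne : q = b
  · rwa [← hne]
  have hbR : insert b (S \ {p, q, b}) = S \ {p, q} := by
    ext j; simp only [mem_insert, mem_sdiff, mem_singleton]; grind
  have hqR : insert q (S \ {p, q, b}) = S \ {p, b} := by
    ext j; simp only [mem_insert, mem_sdiff, mem_singleton]; grind
  rw [← hqR]
  rw [← hbR] at h
  exact h.exchange (by simp) (by simp) hqb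

/-- If `a < b` are the last two of the first `k + 2` objects, in order of decreasing value, then
they may be removed at the cost of one group. -/
theorem HasShare.sdiff_pair {β : Type*} [LinearOrder β] {w : β → ℝ} (hw : ∀ j, 0 ≤ w j)
    (hanti : Antitone w) {S T : Finset β} {k : ℕ} {t : ℝ} (h : HasShare w S (k + 1) t)
    (hTS : T ⊆ S) (hT : T.card = k + 2) {a b : β} (ha : a ∈ T) (hb : b ∈ T) (hab : a < b)
    (hTb : ∀ x ∈ T, x ≤ b) (hTa : ∀ x ∈ T, x < b → x ≤ a) :
    HasShare w (S \ {a, b}) k t := by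
  obtain ⟨c, K, hK, hmem, hc⟩ := h.exists_mem hw
  obtain ⟨p, hp, q, hq, hpq, hcpq⟩ : ∃ p ∈ T, ∃ q ∈ T, p < q ∧ c p = c q := by
    obtain ⟨p, hp, q, hq, hne, hcpq⟩ :=
      exists_ne_map_eq_of_card_lt_of_maps_to (s := T) (t := K) (f := c) (by omega)
        fun j _ => hmem j
    rcases lt_or_gt_of_ne hne with hlt | hlt
    · exact ⟨p, hp, q, hq, hlt, hcpq⟩
    · exact ⟨q, hq, p, hp, hlt, hcpq.symm⟩
  have hpb : p < b := hpq.trans_le (hTb q hq)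
  have hpair : HasShare w (S \ {p, q}) k t :=
    HasShare.of_monochromatic hK hc (hmem q) (by simp [hcpq])
  have hpb_share := hpair.sdiff_pair_exchange (hTS hq) (hTS hb) hpq.ne hpb.ne (hanti (hTb q hq))
  rw [pair_comm] at hpb_share ⊢
  exact hpb_share.sdiff_pair_exchange (hTS hp) (hTS ha) hpb.ne' hab.ne' (hanti (hTa p hp hpb))

theorem HasShare.mul_le_sum {β : Type*} {w : β → ℝ} (hw : ∀ j, 0 ≤ w j) {S : Finset β} {k : ℕ}
    {t : ℝ} (h : HasShare w S k t) : k * t ≤ ∑ j ∈ S, w j := by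
  obtain ⟨c, K, rfl, hc⟩ := h
  calc (K.card : ℝ) * t = ∑ _x ∈ K, t := by simp
    _ ≤ ∑ x ∈ K, ∑ j ∈ S with c j = x, w j := sum_le_sum hc
    _ ≤ ∑ j ∈ S, w j := sum_fiberwise_le_sum_of_sum_fiber_nonneg
        fun _ _ => sum_nonneg fun _ _ => hw _

/-- Starting from a set `H₀` worth at most `2 / 3` to everyone, add objects worth at most `1 / 3`
until some agent is satisfied with the bag; the bag is then worth at most `1` to everyone. -/
theorem exists_bag {ι β : Type*} [DecidableEq β] {w : ι → β → ℝ} {A : Finset ι} {t : ι → ℝ}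
    (ht : ∀ i, 0 ≤ t i) {H₀ L : Finset β} (hdisj : Disjoint H₀ L)
    (hH : ∀ i ∈ A, ∑ j ∈ H₀, w i j ≤ 2 / 3 * t i) (hL : ∀ i ∈ A, ∀ j ∈ L, w i j ≤ 1 / 3 * t i)
    {i₁ : ι} (hi₁ : i₁ ∈ A) (htotal : 2 / 3 * t i₁ ≤ ∑ j ∈ H₀ ∪ L, w i₁ j) :
    ∃ B ⊆ L, (∃ i ∈ A, 2 / 3 * t i ≤ ∑ j ∈ H₀ ∪ B, w i j) ∧
      ∀ i ∈ A, ∑ j ∈ H₀ ∪ B, w i j ≤ t i := by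
  induction L using Finset.induction_on generalizing i₁ with
  | empty =>
    refine ⟨∅, subset_rfl, ⟨i₁, hi₁, htotal⟩, fun i hi => ?_⟩
    have := hH i hi
    have := ht i
    rw [union_empty]
    linarith
  | insert b L hb ih =>
    have hbH : b ∉ H₀ := fun h => disjoint_left.1 hdisj h (mem_insert_self b L)
    have hdisjL : Disjoint H₀ L := hdisj.mono_right (subset_insert b L)
    by_cases hex : ∃ i ∈ A, 2 / 3 * t i ≤ ∑ j ∈ H₀ ∪ L, w i j
    · obtain ⟨i₂, hi₂, hle⟩ := hex
      obtain ⟨B, hB, hbag⟩ :=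
        ih hdisjL (fun i hi j hj => hL i hi j (mem_insert_of_mem hj)) hi₂ hle
      exact ⟨B, hB.trans (subset_insert b L), hbag⟩
    · push Not at hex
      refine ⟨insert b L, subset_rfl, ⟨i₁, hi₁, htotal⟩, fun i hi => ?_⟩
      have h1 := hex i hi
      have h2 := hL i hi b (mem_insert_self b L)
      rw [union_insert, sum_insert (by simp [hb, hbH])]
      linarith

/-- Bag filling: at most one large object per agent, all other objects small. -/
theorem hasAllocation_of_small {ι β : Type*} [DecidableEq ι] [DecidableEq β] [Nonempty ι]
    {w : ι → β → ℝ} (hw : ∀ i j, 0 ≤ w i j) {t : ι → ℝ} (ht : ∀ i, 0 ≤ t i) (n : ℕ) :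
    ∀ (A : Finset ι) (H L : Finset β), A.card = n → H.card ≤ n → Disjoint H L →
      (∀ i ∈ A, ∀ j ∈ H, w i j ≤ 2 / 3 * t i) → (∀ i ∈ A, ∀ j ∈ L, w i j ≤ 1 / 3 * t i) →
      (∀ i ∈ A, n * t i ≤ ∑ j ∈ H ∪ L, w i j) → HasAllocation w A (H ∪ L) t := by
  induction n with
  | zero =>
    intro A H L hA _ _ _ _ _
    rw [card_eq_zero] at hA
    exact ⟨fun _ => Classical.arbitrary ι, by simp [hA]⟩
  | succ n ih =>
    intro A H L hA hH hdisj hHw hLw htotal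
    obtain ⟨i₁, hi₁⟩ : A.Nonempty := card_pos.1 (by omega)
    obtain ⟨H₀, hH₀, hcard, hH₀w⟩ : ∃ H₀ ⊆ H, (H \ H₀).card ≤ n ∧
        ∀ i ∈ A, ∑ j ∈ H₀, w i j ≤ 2 / 3 * t i := by
      rcases H.eq_empty_or_nonempty with rfl | ⟨h, hh⟩
      · refine ⟨∅, subset_rfl, by simp, fun i _ => ?_⟩
        have := ht i
        rw [sum_empty]
        positivity
      · refine ⟨{h}, by simpa using hh, ?_, fun i hi => by simpa using hHw i hi h hh⟩
        rw [card_sdiff_of_subset (by simpa using hh), card_singleton]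
        omega
    have hdisj₀ : Disjoint H₀ L := hdisj.mono_left hH₀
    have hsplit : H ∪ L = (H \ H₀) ∪ (H₀ ∪ L) := by
      rw [← union_assoc, sdiff_union_of_subset hH₀]
    have hstart : 2 / 3 * t i₁ ≤ ∑ j ∈ H₀ ∪ L, w i₁ j := by
      have h1 := htotal i₁ hi₁
      have hd : Disjoint (H \ H₀) (H₀ ∪ L) :=
        disjoint_union_right.2 ⟨sdiff_disjoint, hdisj.mono_left sdiff_subset⟩
      rw [hsplit, sum_union hd] at h1
      have h2 : ∑ j ∈ H \ H₀, w i₁ j ≤ (H \ H₀).card • (2 / 3 * t i₁) :=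
        sum_le_card_nsmul _ _ _ fun j hj => hHw i₁ hi₁ j (mem_sdiff.1 hj).1
      have h3 : ((H \ H₀).card : ℝ) ≤ n := by exact_mod_cast hcard
      have h4 := mul_le_mul_of_nonneg_right h3 (ht i₁)
      have h5 := mul_nonneg (Nat.cast_nonneg (α := ℝ) n) (ht i₁)
      have h6 := ht i₁
      rw [nsmul_eq_mul] at h2
      push_cast at h1
      linarith
    obtain ⟨B, hBL, ⟨i₂, hi₂, hle⟩, hbag⟩ := exists_bag ht hdisj₀ hH₀w hLw hi₁ hstart
    have hsub : H₀ ∪ B ⊆ H ∪ L := union_subset_union hH₀ hBL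
    have hrest : (H ∪ L) \ (H₀ ∪ B) = (H \ H₀) ∪ (L \ B) := by
      ext j
      have h1 := @disjoint_left _ H L
      have h2 := @hH₀ j
      have h3 := @hBL j
      simp only [mem_union, mem_sdiff]
      grind
    refine HasAllocation.of_erase hw hsub hle ?_
    have hmem : ∀ i ∈ A.erase i₂, i ∈ A := fun i hi => mem_of_mem_erase hi
    rw [hrest]
    refine ih _ _ _ (by rw [card_erase_of_mem hi₂]; omega) hcard
      (hdisj.mono sdiff_subset sdiff_subset)
      (fun i hi j hj => hHw i (hmem i hi) j (mem_sdiff.1 hj).1)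
      (fun i hi j hj => hLw i (hmem i hi) j (mem_sdiff.1 hj).1) fun i hi => ?_
    have h1 := htotal i (hmem i hi)
    have h2 := hbag i (hmem i hi)
    rw [← sum_sdiff hsub, hrest] at h1
    push_cast at h1
    linarith

/-- Every finite subset of a linear order has initial segments of all possible sizes. -/
theorem exists_initial_segment {β : Type*} [LinearOrder β] (S : Finset β) {m : ℕ}
    (hm : m ≤ S.card) : ∃ T ⊆ S, T.card = m ∧ ∀ x ∈ T, ∀ y ∈ S, y ∉ T → x < y := by
  induction m with
  | zero => exact ⟨∅, by simp⟩
  | succ m ih =>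
    obtain ⟨T, hTS, hT, hlt⟩ := ih (by omega)
    have hne : (S \ T).Nonempty := by
      rw [← card_pos, card_sdiff_of_subset hTS]
      omega
    have hmin := mem_sdiff.1 (min'_mem (S \ T) hne)
    refine ⟨insert ((S \ T).min' hne) T, insert_subset hmin.1 hTS, ?_, fun x hx y hy hyT => ?_⟩
    · rw [card_insert_of_notMem hmin.2, hT]
    · rw [mem_insert, not_or] at hyT
      rcases mem_insert.1 hx with rfl | hx
      · exact lt_of_le_of_ne (min'_le _ _ (mem_sdiff.2 ⟨hy, hyT.2⟩)) (Ne.symm hyT.1)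
      · exact hlt x hx y hy hyT.2

/-- The theorem for agents who agree on the order of the objects. -/
theorem hasAllocation_of_antitone {ι β : Type*} [DecidableEq ι] [LinearOrder β] [Nonempty ι]
    {w : ι → β → ℝ} (hw : ∀ i j, 0 ≤ w i j) (hanti : ∀ i, Antitone (w i)) {t : ι → ℝ}
    (ht : ∀ i, 0 ≤ t i) (n : ℕ) :
    ∀ (A : Finset ι) (S : Finset β), A.card = n → (∀ i ∈ A, HasShare (w i) S n (t i)) →
      HasAllocation w A S t := by
  induction n with
  | zero =>
    intro A S hA _
    rw [card_eq_zero] at hA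
    exact ⟨fun _ => Classical.arbitrary ι, by simp [hA]⟩
  | succ n ih =>
    intro A S hA hshare
    have hcard : ∀ i ∈ A, (A.erase i).card = n := fun i hi => by
      rw [card_erase_of_mem hi]; omega
    have htotal : ∀ i ∈ A, ((n + 1 : ℕ) : ℝ) * t i ≤ ∑ j ∈ S, w i j :=
      fun i hi => (hshare i hi).mul_le_sum (hw i)
    by_cases hsingle : ∃ i ∈ A, ∃ g ∈ S, 2 / 3 * t i ≤ w i g
    · obtain ⟨i₀, hi₀, g, hg, hle⟩ := hsingle
      refine HasAllocation.of_erase hw (B := {g}) (by simpa using hg) (by simpa using hle) ?_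
      exact ih _ _ (hcard i₀ hi₀) fun i hi =>
        (hshare i (mem_of_mem_erase hi)).sdiff_singleton (hw i) g
    push Not at hsingle
    rcases le_or_gt S.card (n + 1) with hS | hS
    · have := hasAllocation_of_small hw ht (n + 1) A S ∅ hA hS (disjoint_empty_right S)
        (fun i hi j hj => (hsingle i hi j hj).le) (by simp) (by simpa using htotal)
      simpa using this
    obtain ⟨T, hTS, hT, hlt⟩ := exists_initial_segment S (m := n + 2) (by omega)
    have hTne : T.Nonempty := card_pos.1 (by omega)
    obtain ⟨b, hb, hTb⟩ : ∃ b ∈ T, ∀ x ∈ T, x ≤ b := ⟨T.max' hTne, max'_mem _ _, le_max' T⟩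
    have hHcard : (T.erase b).card = n + 1 := by rw [card_erase_of_mem hb]; omega
    have hHne : (T.erase b).Nonempty := card_pos.1 (by omega)
    obtain ⟨a, ha, hHa⟩ : ∃ a ∈ T.erase b, ∀ x ∈ T.erase b, x ≤ a :=
      ⟨(T.erase b).max' hHne, max'_mem _ _, le_max' _⟩
    have haT := mem_of_mem_erase ha
    have hab : a < b := lt_of_le_of_ne (hTb a haT) (ne_of_mem_erase ha)
    by_cases hpair : ∃ i ∈ A, 2 / 3 * t i ≤ w i a + w i b
    · obtain ⟨i₀, hi₀, hle⟩ := hpair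
      refine HasAllocation.of_erase hw (B := {a, b}) (i₀ := i₀) ?_
        (by rwa [sum_pair hab.ne]) ?_
      · simp [insert_subset_iff, hTS haT, hTS hb]
      · exact ih _ _ (hcard i₀ hi₀) fun i hi =>
          (hshare i (mem_of_mem_erase hi)).sdiff_pair (hw i) (hanti i) hTS hT haT hb hab hTb
            fun x hx hxb => hHa x (mem_erase.2 ⟨hxb.ne, hx⟩)
    push Not at hpair
    have hHS : T.erase b ⊆ S := (erase_subset b T).trans hTS
    have hunion : T.erase b ∪ S \ T.erase b = S := union_sdiff_of_subset hHS
    rw [← hunion]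
    refine hasAllocation_of_small hw ht (n + 1) A _ _ hA hHcard.le disjoint_sdiff
      (fun i hi j hj => (hsingle i hi j (hHS hj)).le) (fun i hi j hj => ?_) (by rwa [hunion])
    have hbj : b ≤ j := by
      rw [mem_sdiff, mem_erase, not_and, not_imp_not] at hj
      by_cases hjT : j ∈ T
      · exact (hj.2 hjT).ge
      · exact (hlt b hb j hj.1 hjT).le
    have h1 := hanti i hbj
    have h2 := hanti i hab.le
    have h3 := hpair i hi
    linarith

/-- Picking sequence: if each agent's `j`-th favourite object is `σ i j`, then the slots `j` can be
matched bijectively to objects so that the owner `f j` of the slot likes its object at least as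
much as its own `j`-th favourite. -/
theorem exists_picking_equiv {ι α : Type*} [Fintype α] [DecidableEq α] {m : ℕ}
    (hm : Fintype.card α = m) (v : ι → α → ℝ) (σ : ι → Fin m ≃ α)
    (hσ : ∀ i, Antitone fun j => v i (σ i j)) (f : Fin m → ι) :
    ∃ p : Fin m ≃ α, ∀ j, v (f j) (σ (f j) j) ≤ v (f j) (p j) := by
  classical
  obtain ⟨p, hp, hpt⟩ := (all_card_le_biUnion_card_iff_exists_injective
    fun j => univ.filter fun x => v (f j) (σ (f j) j) ≤ v (f j) x).1 fun s => by
      rcases s.eq_empty_or_nonempty with rfl | hs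
      · simp
      calc s.card ≤ (Iic (s.max' hs)).card := card_le_card fun j hj => by
            simpa using le_max' s j hj
        _ = ((Iic (s.max' hs)).map (σ (f (s.max' hs))).toEmbedding).card := (card_map _).symm
        _ ≤ _ := card_le_card fun x hx => by
            obtain ⟨j, hj, rfl⟩ := mem_map.1 hx
            refine mem_biUnion.2 ⟨s.max' hs, max'_mem s hs, ?_⟩
            simpa using hσ (f (s.max' hs)) (mem_Iic.1 hj)
  refine ⟨Equiv.ofBijective p ((Fintype.bijective_iff_injective_and_card p).2 ⟨hp, by simp [hm]⟩),
    fun j => ?_⟩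
  simpa using hpt j

theorem exists_antitone_equiv {α : Type*} [Fintype α] (v : α → ℝ) :
    ∃ σ : Fin (Fintype.card α) ≃ α, Antitone fun j => v (σ j) := by
  let e := (Fintype.equivFin α).symm
  refine ⟨(Tuple.sort fun j => -v (e j)).trans e, fun j k hjk => ?_⟩
  have := Tuple.monotone_sort (fun j => -v (e j)) hjk
  simpa using this

theorem eq_sum_singleton_of_additive {α : Type*} [DecidableEq α] {V : Finset α → ℝ}
    (hadd : ∀ A B, Disjoint A B → V (A ∪ B) = V A + V B) (A : Finset α) :
    V A = ∑ a ∈ A, V {a} := by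
  induction A using Finset.induction_on with
  | empty =>
    have := hadd ∅ ∅ (disjoint_empty_left _)
    rw [union_empty] at this
    rw [sum_empty]
    linarith
  | insert a A ha ih =>
    rw [sum_insert ha, ← ih, insert_eq, hadd _ _ (disjoint_singleton_left.2 ha)]

theorem MMS_one_nonneg {α : Type*} [Fintype α] [DecidableEq α] {V : Finset α → ℝ}
    (hV : ∀ A, 0 ≤ V A) (n : ℕ) : 0 ≤ MMS V 1 n := by
  refine Real.sSup_nonneg ?_
  rintro _ ⟨P, -, -, rfl⟩
  refine Real.sInf_nonneg ?_
  rintro _ ⟨S, -, rfl⟩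
  exact hV _

theorem exists_partition_MMS_le {α : Type*} [Fintype α] [DecidableEq α] {V : Finset α → ℝ}
    (hV : ∀ A, 0 ≤ V A) {n : ℕ} (hn : 0 < n) :
    ∃ P : Fin n → Finset α, (∀ i j, i ≠ j → Disjoint (P i) (P j)) ∧
      univ.biUnion P = univ ∧ ∀ k, MMS V 1 n ≤ V (P k) := by
  have hmem : MMS V 1 n ∈ { t : ℝ | ∃ P : Fin n → Finset α,
      (∀ i j, i ≠ j → Disjoint (P i) (P j)) ∧ univ.biUnion P = univ ∧
      t = sInf { u : ℝ | ∃ S : Finset (Fin n), S.card = 1 ∧ u = V (S.biUnion P) } } := by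
    refine Set.Nonempty.csSup_mem ?_ ?_
    · refine ⟨_, fun i => if i = ⟨0, hn⟩ then univ else ∅, fun i j hij => ?_, ?_, rfl⟩
      · dsimp only
        split_ifs with hi hj
        · exact absurd (hi.trans hj.symm) hij
        all_goals simp
      · exact eq_univ_of_forall fun x => mem_biUnion.2 ⟨⟨0, hn⟩, mem_univ _, by simp⟩
    · refine (Set.finite_range fun P : Fin n → Finset α =>
        sInf { u : ℝ | ∃ S : Finset (Fin n), S.card = 1 ∧ u = V (S.biUnion P) }).subset ?_
      rintro _ ⟨P, -, -, rfl⟩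
      exact ⟨P, rfl⟩
  obtain ⟨P, hdisj, hcover, hP⟩ := hmem
  refine ⟨P, hdisj, hcover, fun k => ?_⟩
  rw [hP]
  refine csInf_le ⟨0, ?_⟩ ⟨{k}, card_singleton k, by rw [singleton_biUnion]⟩
  rintro _ ⟨S, -, rfl⟩
  exact hV _

theorem hasShare_MMS {α β : Type*} [Fintype α] [DecidableEq α] [Fintype β] {V : Finset α → ℝ}
    (hV : ∀ A, 0 ≤ V A) (hadd : ∀ A B, Disjoint A B → V (A ∪ B) = V A + V B) {n : ℕ} (hn : 0 < n)
    (σ : β ≃ α) : HasShare (fun j => V {σ j}) univ n (MMS V 1 n) := by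
  obtain ⟨P, hdisj, hcover, hP⟩ := exists_partition_MMS_le hV hn
  have hex : ∀ x, ∃ k, x ∈ P k := fun x => by
    have := mem_univ x
    rw [← hcover, mem_biUnion] at this
    simpa using this
  choose c hc using hex
  refine ⟨fun j => c (σ j), range n, card_range n, fun k hk => ?_⟩
  refine (hP ⟨k, mem_range.1 hk⟩).trans_eq ?_
  rw [eq_sum_singleton_of_additive hadd]
  symm
  refine sum_equiv σ (fun j => ?_) fun _ _ => rfl
  simp only [mem_filter, mem_univ, true_and]
  constructor
  · intro h
    have := hc (σ j)
    rwa [show c (σ j) = ⟨k, mem_range.1 hk⟩ from Fin.ext h] at this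
  · intro h
    by_contra hne
    refine disjoint_left.1 (hdisj (c (σ j)) ⟨k, mem_range.1 hk⟩ fun heq => hne ?_) (hc _) h
    rw [heq]

/-- for `n ≥ 2` agents with nonnegative additive valuations over a
finite set of objects, there is a partition of all the objects into `n` bundles
giving each agent `i` at least `2/3` of its 1-out-of-n maximin share. -/
theorem exists_two_thirds_MMS_allocation
    {α : Type*} [Fintype α] [DecidableEq α] (n : ℕ) (hn : 2 ≤ n)
    (Val : Fin n → Finset α → ℝ)
    (hnonneg : ∀ i A, 0 ≤ Val i A)
    (hadd : ∀ i A B, Disjoint A B → Val i (A ∪ B) = Val i A + Val i B) :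
    ∃ Z : Fin n → Finset α,
      (∀ i j, i ≠ j → Disjoint (Z i) (Z j)) ∧
      Finset.univ.biUnion Z = Finset.univ ∧
      ∀ i, (2 / 3 : ℝ) * MMS (Val i) 1 n ≤ Val i (Z i) := by
  have hpos : 0 < n := by omega
  have : Nonempty (Fin n) := ⟨⟨0, hpos⟩⟩
  choose σ hσ using fun i => exists_antitone_equiv fun a => Val i {a}
  obtain ⟨f, hf⟩ := hasAllocation_of_antitone (w := fun i j => Val i {σ i j})
    (fun i j => hnonneg _ _) hσ (t := fun i => MMS (Val i) 1 n)
    (fun i => MMS_one_nonneg (hnonneg i) n) n univ univ (by simp)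
    fun i _ => hasShare_MMS (hnonneg i) (hadd i) hpos (σ i)
  obtain ⟨p, hp⟩ := exists_picking_equiv rfl (fun i a => Val i {a}) σ hσ f
  refine ⟨fun i => univ.filter fun a => f (p.symm a) = i, fun i j hij => ?_, ?_, fun i => ?_⟩
  · refine disjoint_filter.2 fun a _ hi hj => hij (hi.symm.trans hj)
  · exact eq_univ_of_forall fun a => mem_biUnion.2 ⟨f (p.symm a), mem_univ _, by simp⟩
  · rw [eq_sum_singleton_of_additive (hadd i)]
    refine (hf i (mem_univ i)).trans ?_
    calc ∑ j with f j = i, Val i {σ i j} ≤ ∑ j with f j = i, Val i {p j} :=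
          sum_le_sum fun j hj => by
            obtain rfl := (mem_filter.1 hj).2
            exact hp j
      _ = _ := sum_equiv p (fun j => by simp) fun _ _ => rfl
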